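/- arXiv:1007.3921 — 2 statements merged into one kernel-verified Lean document; each statement's English description precedes it below -/
import Mathlib

section
/- Let f satisfy (H2). Then for each z ∈ E∖{0} there exists a unique V_z ∈ C²([0,+∞)) satisfying V_z''(ξ) + f(V_z(ξ)) = 0 for all ξ ≥ 0, V_z(0) = 0, 0 < V_z(ξ) < z for all ξ > 0, and V_z(ξ) → z as ξ → +∞. Moreover V_z'(ξ) > 0 for all ξ ≥ 0. -/
open Set Filter

noncomputable section

/-- Partial derivative of `u` in the `i`-th coordinate direction. -/
def pd {N : ℕ} (i : Fin N) (u : (Fin N → ℝ) → ℝ) (x : Fin N → ℝ) : ℝ :=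
  deriv (fun t => u (Function.update x i t)) (x i)

/-- Laplace operator: the sum of the pure second partial derivatives. -/
def lap {N : ℕ} (u : (Fin N → ℝ) → ℝ) (x : Fin N → ℝ) : ℝ :=
  ∑ i, pd i (pd i u) x

/-- `f` is locally Lipschitz-continuous on `[0, +∞)`. -/
def LocLipOn (f : ℝ → ℝ) : Prop :=
  ∀ b : ℝ, ∃ L : NNReal, LipschitzOnWith L f (Set.Icc 0 b)

/-- Hypothesis (H1): `f` is locally Lipschitz on `[0,∞)`, positive on `(0,μ)`, nonpositive on
`[μ,∞)`, nonincreasing on `[μ',μ]`, and either `f(0) > 0` or `f(0) = 0` with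
`liminf_{s→0⁺} f(s)/s > 0`. -/
def H1 (f : ℝ → ℝ) (μ' μ : ℝ) : Prop :=
  LocLipOn f ∧ 0 < μ' ∧ μ' < μ ∧
  (∀ s, 0 < s → s < μ → 0 < f s) ∧
  (∀ s, μ ≤ s → f s ≤ 0) ∧
  (∀ s t, μ' ≤ s → s ≤ t → t ≤ μ → f t ≤ f s) ∧
  (0 < f 0 ∨ (f 0 = 0 ∧ ∃ c > 0, ∀ᶠ s in nhdsWithin (0:ℝ) (Set.Ioi 0), c ≤ f s / s))

/-- Hypothesis (H2): `f` is locally Lipschitz and nonnegative on `[0,∞)`, and at every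
nonnegative zero `z` of `f`, `liminf_{s→z⁺} f(s)/(s-z) > 0`. -/
def H2 (f : ℝ → ℝ) : Prop :=
  LocLipOn f ∧ (∀ s, 0 ≤ s → 0 ≤ f s) ∧
  (∀ z, 0 ≤ z → f z = 0 → ∃ c > 0, ∀ᶠ s in nhdsWithin z (Set.Ioi z), c ≤ f s / (s - z))

/-- Hypothesis (H3): `liminf_{s→z⁻} f(s)/(s-z) > 0` for every zero `z > μ` of `f`. -/
def H3 (f : ℝ → ℝ) (μ : ℝ) : Prop :=
  ∀ z, μ < z → f z = 0 → ∃ c > 0, ∀ᶠ s in nhdsWithin z (Set.Iio z), c ≤ f s / (s - z)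

/-- `(V, V')` is a `C²` solution on `[0,+∞)` of `V'' + f(V) = 0` with `V(0) = 0`,
`0 < V < z` on `(0,+∞)` and `V(+∞) = z` (the one-dimensional profile `V_z`). -/
def IsProfile (f : ℝ → ℝ) (z : ℝ) (V V' : ℝ → ℝ) : Prop :=
  (∀ ξ ∈ Set.Ici (0:ℝ), HasDerivWithinAt V (V' ξ) (Set.Ici 0) ξ) ∧
  (∀ ξ ∈ Set.Ici (0:ℝ), HasDerivWithinAt V' (-(f (V ξ))) (Set.Ici 0) ξ) ∧
  V 0 = 0 ∧ (∀ ξ, 0 < ξ → 0 < V ξ ∧ V ξ < z) ∧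
  Filter.Tendsto V Filter.atTop (nhds z)

/-- The translates `x ↦ u(x + h e₁)` converge as `h → +∞`, uniformly on `K` together with all
partial derivatives up to order two, to the limits `w`, `w1 i`, `w2 i j`. -/
def C2ConvOn {N : ℕ} (i0 : Fin N) (u : (Fin N → ℝ) → ℝ) (K : Set (Fin N → ℝ))
    (w : (Fin N → ℝ) → ℝ) (w1 : Fin N → (Fin N → ℝ) → ℝ)
    (w2 : Fin N → Fin N → (Fin N → ℝ) → ℝ) : Prop :=
  TendstoUniformlyOn (fun (h : ℝ) x => u (Function.update x i0 (x i0 + h))) w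
    Filter.atTop K ∧
  (∀ i, TendstoUniformlyOn (fun (h : ℝ) x => pd i u (Function.update x i0 (x i0 + h)))
      (w1 i) Filter.atTop K) ∧
  (∀ i j, TendstoUniformlyOn
      (fun (h : ℝ) x => pd i (pd j u) (Function.update x i0 (x i0 + h)))
      (w2 i j) Filter.atTop K)

/-- `F(z) = ∫₀^z f(σ) dσ`. -/
def Ff (f : ℝ → ℝ) (z : ℝ) : ℝ := ∫ σ in (0:ℝ)..z, f σ

/-- The set `Z_f = {z₀ ≥ 0 : f(z₀) = 0 and F(z) < F(z₀) for all z ∈ [0,z₀)}`. -/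
def Zf (f : ℝ → ℝ) : Set ℝ :=
  {z | 0 ≤ z ∧ f z = 0 ∧ ∀ w, 0 ≤ w → w < z → Ff f w < Ff f z}

/-- `(V, V')` belongs to `R_f`: a bounded nonnegative `C²` solution on `[0,∞)` of
`V'' + f(V) = 0` with `V(0) = 0`. -/
def InRf (f V V' : ℝ → ℝ) : Prop :=
  (∀ ξ ∈ Set.Ici (0:ℝ), HasDerivWithinAt V (V' ξ) (Set.Ici 0) ξ) ∧
  (∀ ξ ∈ Set.Ici (0:ℝ), HasDerivWithinAt V' (-(f (V ξ))) (Set.Ici 0) ξ) ∧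
  V 0 = 0 ∧ (∀ ξ, 0 ≤ ξ → 0 ≤ V ξ) ∧ (∃ C, ∀ ξ, 0 ≤ ξ → V ξ ≤ C)

open Topology

lemma LocLipOn.continuousOn {f : ℝ → ℝ} (hf : LocLipOn f) : ContinuousOn f (Ici 0) := by
  intro x hx
  obtain ⟨L, hL⟩ := hf (x + 1)
  have hxI : x ∈ Icc 0 (x + 1) := ⟨hx, by linarith⟩
  refine (hL.continuousOn x hxI).mono_of_mem_nhdsWithin ?_
  filter_upwards [self_mem_nhdsWithin,
    mem_nhdsWithin_of_mem_nhds (Iio_mem_nhds (lt_add_one x))] with y hy hy'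
  exact ⟨hy, le_of_lt hy'⟩

lemma LocLipOn.continuous_comp_max {f : ℝ → ℝ} (hf : LocLipOn f) :
    Continuous fun s => f (max 0 s) :=
  hf.continuousOn.comp_continuous (by fun_prop) fun s => le_max_left 0 s

/-- The primitive of `f` vanishing at `0`, where `f` is extended to the negative half-line by the
constant `f 0`. -/
def potential (f : ℝ → ℝ) (v : ℝ) : ℝ := ∫ s in (0 : ℝ)..v, f (max 0 s)

/-- The slope at height `v` of a profile increasing to `z`, as given by conservation of energy,
extended to negative heights by its value at `0`. -/
def speed (f : ℝ → ℝ) (z v : ℝ) : ℝ := √(2 * (potential f z - potential f (max 0 v)))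

/-- The time that a profile increasing to `z` needs to go from height `0` to height `v`. -/
def travelTime (f : ℝ → ℝ) (z v : ℝ) : ℝ := ∫ s in (0 : ℝ)..v, (speed f z s)⁻¹

lemma hasDerivAt_potential {f : ℝ → ℝ} (hf : LocLipOn f) (v : ℝ) :
    HasDerivAt (potential f) (f (max 0 v)) v :=
  hf.continuous_comp_max.integral_hasStrictDerivAt 0 v |>.hasDerivAt

lemma continuous_potential {f : ℝ → ℝ} (hf : LocLipOn f) : Continuous (potential f) :=
  continuous_iff_continuousAt.2 fun v => (hasDerivAt_potential hf v).continuousAt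

lemma potential_sub_potential {f : ℝ → ℝ} (hf : LocLipOn f) (v z : ℝ) :
    potential f z - potential f v = ∫ s in v..z, f (max 0 s) :=
  intervalIntegral.integral_interval_sub_left (μ := MeasureTheory.volume)
    (hf.continuous_comp_max.intervalIntegrable _ _) (hf.continuous_comp_max.intervalIntegrable _ _)

lemma H2.exists_pos {f : ℝ → ℝ} (hf : H2 f) {a b : ℝ} (ha : 0 ≤ a) (hab : a < b) :
    ∃ s ∈ Ico a b, 0 < f s := by
  rcases (hf.2.1 a ha).lt_or_eq with h | h
  · exact ⟨a, ⟨le_rfl, hab⟩, h⟩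
  · obtain ⟨c, hc, hev⟩ := hf.2.2 a ha h.symm
    obtain ⟨s, hs, hs'⟩ := (hev.and (Ioo_mem_nhdsGT hab)).exists
    refine ⟨s, ⟨hs'.1.le, hs'.2⟩, ?_⟩
    have hsa : 0 < s - a := sub_pos.2 hs'.1
    exact (div_pos_iff_of_pos_right hsa).1 (hc.trans_le hs)

lemma H2.strictMonoOn_potential {f : ℝ → ℝ} (hf : H2 f) : StrictMonoOn (potential f) (Ici 0) := by
  intro v hv z _ hvz
  rw [← sub_pos, potential_sub_potential hf.1]
  obtain ⟨s, hs, hfs⟩ := hf.exists_pos hv hvz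
  refine intervalIntegral.integral_pos hvz hf.1.continuous_comp_max.continuousOn
    (fun x _ => hf.2.1 _ (le_max_left 0 x)) ⟨s, ⟨hs.1, hs.2.le⟩, ?_⟩
  rwa [max_eq_right (le_trans hv hs.1)]

lemma continuous_speed {f : ℝ → ℝ} (hf : LocLipOn f) (z : ℝ) : Continuous (speed f z) := by
  have := continuous_potential hf
  unfold speed
  fun_prop

lemma H2.speed_pos {f : ℝ → ℝ} (hf : H2 f) {z v : ℝ} (hz : 0 < z) (hv : v < z) :
    0 < speed f z v := by
  have := hf.strictMonoOn_potential (le_max_left 0 v) hz.le (max_lt hz hv)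
  exact Real.sqrt_pos.2 (by linarith)

lemma LocLipOn.exists_speed_le {f : ℝ → ℝ} (hf : LocLipOn f) {z : ℝ} (hfz : f z = 0) :
    ∃ K > 0, ∀ v ∈ Icc 0 z, speed f z v ≤ K * (z - v) := by
  obtain ⟨L, hL⟩ := hf z
  refine ⟨L + 1, by positivity, fun v hv => ?_⟩
  have hvz : 0 ≤ z - v := sub_nonneg.2 hv.2
  have hbound : |potential f z - potential f v| ≤ L * (z - v) * (z - v) := by
    rw [potential_sub_potential hf]
    suffices hle : ∀ s ∈ uIoc v z, ‖f (max 0 s)‖ ≤ L * (z - v) by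
      have := intervalIntegral.norm_integral_le_of_norm_le_const hle
      rwa [abs_of_nonneg hvz] at this
    intro s hs
    rw [uIoc_of_le hv.2] at hs
    have hs0 : 0 ≤ s := hv.1.trans hs.1.le
    have h := hL.dist_le_mul s ⟨hs0, hs.2⟩ z ⟨hv.1.trans hv.2, le_rfl⟩
    rw [Real.dist_eq, Real.dist_eq, hfz, sub_zero, abs_sub_comm, abs_of_nonneg (sub_nonneg.2 hs.2)]
      at h
    rw [max_eq_right hs0, Real.norm_eq_abs]
    exact h.trans (mul_le_mul_of_nonneg_left (by linarith [hs.1]) L.2)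
  rw [speed, max_eq_right hv.1]
  refine Real.sqrt_le_iff.2 ⟨by positivity, ?_⟩
  have h1 := (abs_le.1 hbound).2
  have h2 : 0 ≤ ((L : ℝ) ^ 2 + 1) * (z - v) ^ 2 := by positivity
  nlinarith

lemma H2.hasDerivAt_travelTime {f : ℝ → ℝ} (hf : H2 f) {z v : ℝ} (hz : 0 < z) (hv : v < z) :
    HasDerivAt (travelTime f z) (speed f z v)⁻¹ v := by
  have hc := continuous_speed hf.1 z
  refine intervalIntegral.integral_hasDerivAt_right ?_
    hc.measurable.inv.stronglyMeasurable.stronglyMeasurableAtFilter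
    (hc.continuousAt.inv₀ (hf.speed_pos hz hv).ne')
  refine (hc.continuousOn.inv₀ fun s hs => ?_).intervalIntegrable
  exact (hf.speed_pos hz (hs.2.trans_lt (max_lt hz hv))).ne'

lemma travelTime_zero (f : ℝ → ℝ) (z : ℝ) : travelTime f z 0 = 0 :=
  intervalIntegral.integral_same

lemma H2.continuousOn_travelTime {f : ℝ → ℝ} (hf : H2 f) {z : ℝ} (hz : 0 < z) :
    ContinuousOn (travelTime f z) (Iio z) :=
  fun _ hv => (hf.hasDerivAt_travelTime hz hv).continuousAt.continuousWithinAt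

lemma H2.strictMonoOn_travelTime {f : ℝ → ℝ} (hf : H2 f) {z : ℝ} (hz : 0 < z) :
    StrictMonoOn (travelTime f z) (Iio z) := by
  refine strictMonoOn_of_deriv_pos (convex_Iio z) (hf.continuousOn_travelTime hz) fun v hv => ?_
  rw [interior_Iio] at hv
  rw [(hf.hasDerivAt_travelTime hz hv).deriv]
  exact inv_pos.2 (hf.speed_pos hz hv)

lemma H2.tendsto_travelTime {f : ℝ → ℝ} (hf : H2 f) {z : ℝ} (hz : 0 < z) (hfz : f z = 0) :
    Tendsto (travelTime f z) (𝓝[<] z) atTop := by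
  obtain ⟨K, hK, hle⟩ := hf.1.exists_speed_le hfz
  have hderiv : ∀ v < z, HasDerivAt (fun v => travelTime f z v + K⁻¹ * Real.log (z - v))
      ((speed f z v)⁻¹ + K⁻¹ * (-1 / (z - v))) v := fun v hv =>
    (hf.hasDerivAt_travelTime hz hv).add
      ((((hasDerivAt_id v).const_sub z).log (sub_pos.2 hv).ne').const_mul _)
  have hmono : MonotoneOn (fun v => travelTime f z v + K⁻¹ * Real.log (z - v)) (Ico 0 z) := by
    refine monotoneOn_of_deriv_nonneg (convex_Ico 0 z)
      (fun v hv => (hderiv v hv.2).continuousAt.continuousWithinAt) ?_ ?_ <;>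
      rw [interior_Ico] <;> intro v hv
    · exact (hderiv v hv.2).differentiableAt.differentiableWithinAt
    · rw [(hderiv v hv.2).deriv]
      have h := inv_anti₀ (hf.speed_pos hz hv.2) (hle v ⟨hv.1.le, hv.2.le⟩)
      rw [mul_inv] at h
      rw [neg_div, one_div]
      linarith
  have hlog : Tendsto (fun v => K⁻¹ * Real.log z + K⁻¹ * -Real.log (z - v)) (𝓝[<] z) atTop := by
    refine tendsto_atTop_add_const_left _ _ (Tendsto.const_mul_atTop (inv_pos.2 hK) ?_)
    refine tendsto_neg_atBot_atTop.comp (Real.tendsto_log_nhdsGT_zero.comp ?_)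
    refine tendsto_nhdsWithin_iff.2 ⟨?_, ?_⟩
    · have : Tendsto (fun v => z - v) (𝓝 z) (𝓝 (z - z)) := by
        exact (continuous_const.sub continuous_id).tendsto z
      rw [sub_self] at this
      exact this.mono_left nhdsWithin_le_nhds
    · filter_upwards [self_mem_nhdsWithin] with v hv using sub_pos.2 (mem_Iio.1 hv)
  refine tendsto_atTop_mono' _ ?_ hlog
  filter_upwards [Ioo_mem_nhdsLT hz] with v hv
  have h := hmono ⟨le_rfl, hz⟩ ⟨hv.1.le, hv.2⟩ hv.1.le
  simp only [travelTime_zero, sub_zero] at h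
  linarith

lemma travelTime_of_nonpos (f : ℝ → ℝ) (z : ℝ) {v : ℝ} (hv : v ≤ 0) :
    travelTime f z v = v * (speed f z 0)⁻¹ := by
  have : EqOn (fun s => (speed f z s)⁻¹) (fun _ => (speed f z 0)⁻¹) (uIcc 0 v) := by
    intro s hs
    rw [uIcc_of_ge hv] at hs
    simp only [speed, max_eq_left hs.2, max_self]
  rw [travelTime, intervalIntegral.integral_congr this, intervalIntegral.integral_const]
  simp

lemma H2.surjOn_travelTime {f : ℝ → ℝ} (hf : H2 f) {z : ℝ} (hz : 0 < z) (hfz : f z = 0) :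
    SurjOn (travelTime f z) (Iio z) univ := by
  intro ξ _
  have hs := hf.speed_pos hz hz
  obtain ⟨b, hb, hbz⟩ := (((hf.tendsto_travelTime hz hfz).eventually_ge_atTop ξ).and
    (Ioo_mem_nhdsLT hz)).exists
  set a := min 0 (ξ * speed f z 0)
  have haξ : travelTime f z a ≤ ξ := by
    rw [travelTime_of_nonpos f z (min_le_left _ _), ← div_eq_mul_inv, div_le_iff₀ hs]
    exact min_le_right _ _
  have hab : a ≤ b := (min_le_left _ _).trans hbz.1.le
  have hsub : Icc a b ⊆ Iio z := fun x hx => lt_of_le_of_lt hx.2 hbz.2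
  exact image_mono hsub
    (intermediate_value_Icc hab ((hf.continuousOn_travelTime hz).mono hsub) ⟨haξ, hb⟩)

lemma H2.exists_hasDerivAt_speed {f : ℝ → ℝ} (hf : H2 f) {z : ℝ} (hz : 0 < z) (hfz : f z = 0) :
    ∃ V : ℝ → ℝ, StrictMono V ∧ range V = Iio z ∧ V 0 = 0 ∧
      ∀ ξ, HasDerivAt V (speed f z (V ξ)) ξ := by
  have hmono := hf.strictMonoOn_travelTime hz
  choose V hVz hV using fun ξ => hf.surjOn_travelTime hz hfz (mem_univ ξ)
  have hinv : ∀ v < z, V (travelTime f z v) = v := fun v hv =>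
    hmono.injOn (hVz _) hv (hV _)
  have hVmono : StrictMono V := fun a b hab => by
    rw [← hmono.lt_iff_lt (hVz a) (hVz b), hV, hV]
    exact hab
  have hrange : range V = Iio z :=
    Subset.antisymm (range_subset_iff.2 hVz) fun v hv => ⟨_, hinv v hv⟩
  have hcont : ∀ ξ, ContinuousAt V ξ := fun ξ =>
    (hVmono.strictMonoOn univ).continuousAt_of_image_mem_nhds univ_mem
      (by rw [image_univ, hrange]; exact Iio_mem_nhds (hVz ξ))
  refine ⟨V, hVmono, hrange, ?_, fun ξ => ?_⟩
  · simpa [travelTime_zero] using hinv 0 hz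
  · have h := HasDerivAt.of_local_left_inverse (hcont ξ) (hf.hasDerivAt_travelTime hz (hVz ξ))
      (inv_ne_zero (hf.speed_pos hz (hVz ξ)).ne') (Eventually.of_forall hV)
    rwa [inv_inv] at h

lemma H2.exists_isProfile {f : ℝ → ℝ} (hf : H2 f) {z : ℝ} (hz : 0 < z) (hfz : f z = 0) :
    ∃ V V' : ℝ → ℝ, IsProfile f z V V' := by
  obtain ⟨V, hmono, hrange, hV0, hV⟩ := hf.exists_hasDerivAt_speed hz hfz
  have hVz : ∀ ξ, V ξ < z := fun ξ => hrange.subset (mem_range_self ξ)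
  have hnonneg : ∀ ξ ∈ Ici (0 : ℝ), 0 ≤ V ξ := fun ξ hξ => hV0 ▸ hmono.monotone hξ
  refine ⟨V, fun ξ => speed f z (V ξ), fun ξ _ => (hV ξ).hasDerivWithinAt, fun ξ hξ => ?_, hV0,
    fun ξ hξ => ⟨hV0 ▸ hmono hξ, hVz ξ⟩, ?_⟩
  · have hspeed : ∀ η ∈ Ici (0 : ℝ),
        speed f z (V η) = √(2 * (potential f z - potential f (V η))) := fun η hη => by
      rw [speed, max_eq_right (hnonneg η hη)]
    have hpos := hf.speed_pos hz (hVz ξ)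
    have hpos' := hpos
    rw [hspeed ξ hξ] at hpos'
    have h := ((((hasDerivAt_potential hf.1 (V ξ)).comp ξ (hV ξ)).const_sub
      (potential f z)).const_mul 2).sqrt (Real.sqrt_pos.1 hpos').ne'
    refine (h.hasDerivWithinAt.congr hspeed (hspeed ξ hξ)).congr_deriv ?_
    simp only [Function.comp_apply]
    rw [← hspeed ξ hξ, max_eq_right (hnonneg ξ hξ)]
    field_simp
  · refine tendsto_atTop_isLUB hmono.monotone ?_
    rw [hrange]
    exact isLUB_Iio

lemma monotoneOn_Ici_of_hasDerivWithinAt_nonneg {a : ℝ} {g g' : ℝ → ℝ}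
    (hg : ∀ x ∈ Ici a, HasDerivWithinAt g (g' x) (Ici a) x) (hg' : ∀ x ∈ Ici a, 0 ≤ g' x) :
    MonotoneOn g (Ici a) := by
  refine monotoneOn_of_hasDerivWithinAt_nonneg (f' := g') (convex_Ici a)
    (fun x hx => (hg x hx).continuousWithinAt) (fun x hx => ?_)
    (fun x hx => hg' x (interior_subset hx))
  exact (hg x (interior_subset hx)).mono interior_subset

lemma eq_of_hasDerivWithinAt_Ici_zero {a : ℝ} {g : ℝ → ℝ}
    (hg : ∀ x ∈ Ici a, HasDerivWithinAt g 0 (Ici a) x) {x : ℝ} (hx : x ∈ Ici a) : g x = g a := by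
  have h1 := monotoneOn_Ici_of_hasDerivWithinAt_nonneg hg (fun _ _ => le_rfl)
  have h2 := monotoneOn_Ici_of_hasDerivWithinAt_nonneg (g := fun x => -g x) (g' := fun _ => 0)
    (fun x hx => (hg x hx).neg.congr_deriv neg_zero) (fun _ _ => le_rfl)
  exact le_antisymm (neg_le_neg_iff.1 (h2 self_mem_Ici hx hx)) (h1 self_mem_Ici hx hx)

namespace IsProfile

variable {f : ℝ → ℝ} {z : ℝ} {V V' : ℝ → ℝ}

lemma nonneg (h : IsProfile f z V V') {ξ : ℝ} (hξ : 0 ≤ ξ) : 0 ≤ V ξ := by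
  rcases hξ.eq_or_lt with rfl | hξ
  · exact h.2.2.1.ge
  · exact (h.2.2.2.1 ξ hξ).1.le

lemma lt (h : IsProfile f z V V') (hz : 0 < z) {ξ : ℝ} (hξ : 0 ≤ ξ) : V ξ < z := by
  rcases hξ.eq_or_lt with rfl | hξ
  · exact h.2.2.1.trans_lt hz
  · exact (h.2.2.2.1 ξ hξ).2

lemma antitoneOn_deriv (h : IsProfile f z V V') (hf : H2 f) : AntitoneOn V' (Ici 0) := by
  have := monotoneOn_Ici_of_hasDerivWithinAt_nonneg (fun x hx => (h.2.1 x hx).neg)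
    (fun x hx => by simpa using hf.2.1 _ (h.nonneg hx))
  simpa using this.neg

lemma not_forall_deriv_ge (h : IsProfile f z V V') {δ : ℝ} (hδ : 0 < δ) :
    ¬ ∀ ξ ∈ Ici (0 : ℝ), δ ≤ V' ξ := by
  intro hge
  have hmono := monotoneOn_Ici_of_hasDerivWithinAt_nonneg (g := fun ξ => V ξ - δ * ξ)
    (g' := fun ξ => V' ξ - δ)
    (fun x hx =>
      ((h.1 x hx).sub ((hasDerivWithinAt_id x (Ici 0)).const_mul δ)).congr_deriv (by rw [mul_one]))
    (fun x hx => sub_nonneg.2 (hge x hx))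
  have hle : ∀ᶠ ξ in atTop, δ * ξ ≤ V ξ := by
    filter_upwards [eventually_ge_atTop 0] with ξ hξ
    have := hmono self_mem_Ici hξ hξ
    simp only [h.2.2.1, mul_zero, sub_zero] at this
    linarith
  exact not_tendsto_nhds_of_tendsto_atTop
    (tendsto_atTop_mono' _ hle (tendsto_id.const_mul_atTop hδ)) z h.2.2.2.2

lemma deriv_nonneg (h : IsProfile f z V V') (hf : H2 f) {a : ℝ} (ha : 0 ≤ a) : 0 ≤ V' a := by
  by_contra! hlt
  have hsub : Ici a ⊆ Ici (0 : ℝ) := Ici_subset_Ici.2 ha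
  have hmono := monotoneOn_Ici_of_hasDerivWithinAt_nonneg (a := a) (g := fun ξ => V' a * ξ - V ξ)
    (g' := fun ξ => V' a - V' ξ)
    (fun x hx =>
      (((hasDerivWithinAt_id x (Ici a)).const_mul (V' a)).sub
        ((h.1 x (hsub hx)).mono hsub)).congr_deriv (by rw [mul_one]))
    (fun x hx => sub_nonneg.2 (h.antitoneOn_deriv hf ha (hsub hx) hx))
  have hle : ∀ᶠ ξ in atTop, V ξ ≤ (V a - V' a * a) + V' a * ξ := by
    filter_upwards [eventually_ge_atTop a] with ξ hξ
    have := hmono self_mem_Ici hξ hξ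
    simp only at this
    linarith
  exact not_tendsto_nhds_of_tendsto_atBot
    (tendsto_atBot_mono' _ hle (tendsto_atBot_add_const_left _ _
      (tendsto_id.const_mul_atTop_of_neg hlt))) z h.2.2.2.2

lemma energy_eq (h : IsProfile f z V V') (hf : H2 f) {ξ : ℝ} (hξ : 0 ≤ ξ) :
    V' ξ ^ 2 + 2 * potential f (V ξ) = V' 0 ^ 2 + 2 * potential f (V 0) := by
  refine eq_of_hasDerivWithinAt_Ici_zero
    (g := fun ξ => V' ξ ^ 2 + 2 * potential f (V ξ)) (fun x hx => ?_) hξ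
  refine (((h.2.1 x hx).pow 2).add
    (((hasDerivAt_potential hf.1 (V x)).comp_hasDerivWithinAt x (h.1 x hx)).const_mul 2)
    ).congr_deriv ?_
  rw [max_eq_right (h.nonneg hx)]
  ring

lemma deriv_eq_speed (h : IsProfile f z V V') (hf : H2 f) (hz : 0 < z) {ξ : ℝ} (hξ : 0 ≤ ξ) :
    V' ξ = speed f z (V ξ) := by
  set E := V' 0 ^ 2 + 2 * potential f (V 0)
  have hE' : E = 2 * potential f z := by
    refine le_antisymm ?_ ?_
    · by_contra! hlt
      refine h.not_forall_deriv_ge (Real.sqrt_pos.2 (sub_pos.2 hlt)) fun η hη => ?_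
      refine Real.sqrt_le_iff.2 ⟨h.deriv_nonneg hf hη, ?_⟩
      have h1 := h.energy_eq hf hη
      have h2 := hf.strictMonoOn_potential (h.nonneg hη) hz.le (h.lt hz hη)
      linarith
    · have hlim : Tendsto (fun η => 2 * potential f (V η)) atTop (𝓝 (2 * potential f z)) :=
        (((continuous_potential hf.1).tendsto z).comp h.2.2.2.2).const_mul 2
      refine le_of_tendsto hlim ?_
      filter_upwards [eventually_ge_atTop 0] with η hη
      have h1 := h.energy_eq hf hη
      linarith [sq_nonneg (V' η)]
  have h1 := h.energy_eq hf hξ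
  rw [speed, max_eq_right (h.nonneg hξ), ← Real.sqrt_sq (h.deriv_nonneg hf hξ)]
  congr 1
  linarith

lemma travelTime_eq (h : IsProfile f z V V') (hf : H2 f) (hz : 0 < z) {ξ : ℝ} (hξ : 0 ≤ ξ) :
    travelTime f z (V ξ) = ξ := by
  have key := eq_of_hasDerivWithinAt_Ici_zero (g := fun ξ => travelTime f z (V ξ) - ξ)
    (fun x hx => ?_) hξ
  · simp only [h.2.2.1, travelTime_zero, sub_zero] at key
    linarith
  · refine (((hf.hasDerivAt_travelTime hz (h.lt hz hx)).comp_hasDerivWithinAt x (h.1 x hx)).sub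
      (hasDerivWithinAt_id x (Ici 0))).congr_deriv ?_
    rw [h.deriv_eq_speed hf hz hx, inv_mul_cancel₀ (hf.speed_pos hz (h.lt hz hx)).ne', sub_self]

end IsProfile

/-- Under (H2), for each nonzero zero `z` of `f` there exists a unique `V_z ∈ C²([0,∞))` with
`V_z'' + f(V_z) = 0`, `V_z(0) = 0`, `0 < V_z < z` on `(0,∞)` and `V_z(+∞) = z`; moreover
`V_z' > 0` on `[0,∞)`. -/
theorem stmt_12
    (f : ℝ → ℝ) (hf : H2 f) :
    ∀ z : ℝ, 0 < z → f z = 0 →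
      (∃ V V' : ℝ → ℝ, IsProfile f z V V') ∧
      (∀ V V' W W' : ℝ → ℝ, IsProfile f z V V' → IsProfile f z W W' →
          Set.EqOn V W (Set.Ici 0)) ∧
      (∀ V V' : ℝ → ℝ, IsProfile f z V V' → ∀ ξ, 0 ≤ ξ → 0 < V' ξ) := by
  intro z hz hfz
  refine ⟨hf.exists_isProfile hz hfz, fun V V' W W' hV hW ξ hξ => ?_, fun V V' hV ξ hξ => ?_⟩
  · exact (hf.strictMonoOn_travelTime hz).injOn (hV.lt hz hξ) (hW.lt hz hξ)
      ((hV.travelTime_eq hf hz hξ).trans (hW.travelTime_eq hf hz hξ).symm)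
  · rw [hV.deriv_eq_speed hf hz hξ]
    exact hf.speed_pos hz (hV.lt hz hξ)
end
end

section
/- Let N ≥ 1, let f : [0,+∞) → ℝ be locally Lipschitz-continuous, let u be a bounded nonnegative C² solution of Δu + f(u) = 0 in ℝ^N, and set m = inf_{ℝ^N} u. Then f(m) ≤ 0. -/
open Set Filter

noncomputable section

/-- Second-order necessary condition at a local minimum. -/
lemma IsLocalMin.deriv_deriv_nonneg {g : ℝ → ℝ} {a : ℝ} (h : IsLocalMin g a)
    (hg : ContinuousAt g a) : 0 ≤ deriv (deriv g) a := by
  by_contra! hneg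
  have hmax : IsLocalMax g a := isLocalMax_of_deriv_deriv_neg hneg h.deriv_eq_zero hg
  have hconst : g =ᶠ[nhds a] fun _ => g a := by
    filter_upwards [h, hmax] with x h₁ h₂ using le_antisymm h₂ h₁
  have hzero : deriv (deriv g) a = 0 := by
    rw [hconst.deriv.deriv_eq]
    simp
  exact hneg.ne hzero

lemma neg_two_mul_le_deriv_deriv {g : ℝ → ℝ} (hg : ContDiff ℝ 2 g) {ε a : ℝ}
    (h : ∀ t, g a + ε * a ^ 2 ≤ g t + ε * t ^ 2) : -(2 * ε) ≤ deriv (deriv g) a := by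
  have hd : Differentiable ℝ g := hg.differentiable (by norm_num)
  have hd' : Differentiable ℝ (deriv g) :=
    (contDiff_succ_iff_deriv.1 (show ContDiff ℝ (1 + 1) g from hg)).2.2.differentiable
      (by norm_num)
  have h₁ : deriv (fun t => g t + ε * t ^ 2) = fun t => deriv g t + ε * (2 * t) := by
    funext t
    have := (hd t).hasDerivAt.fun_add (((hasDerivAt_id t).pow 2).const_mul ε)
    simpa using this.deriv
  have h₂ : deriv (deriv fun t => g t + ε * t ^ 2) a = deriv (deriv g) a + 2 * ε := by
    rw [h₁]
    have := (hd' a).hasDerivAt.fun_add (((hasDerivAt_id a).const_mul 2).const_mul ε)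
    simpa [mul_comm] using this.deriv
  have hmin : IsLocalMin (fun t => g t + ε * t ^ 2) a := Eventually.of_forall h
  have hnn := hmin.deriv_deriv_nonneg
    (by have := hd.continuous; fun_prop)
  linarith

lemma pd_pd_eq_deriv_deriv {N : ℕ} (i : Fin N) (u : (Fin N → ℝ) → ℝ) (x : Fin N → ℝ) :
    pd i (pd i u) x = deriv (deriv fun t => u (Function.update x i t)) (x i) := by
  simp [pd, Function.update_idem]

lemma contDiff_comp_update {N : ℕ} {u : (Fin N → ℝ) → ℝ} (hu : ContDiff ℝ 2 u) (x : Fin N → ℝ)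
    (i : Fin N) : ContDiff ℝ 2 fun t => u (Function.update x i t) :=
  hu.comp (contDiff_update 2 x i)

/-- At a global minimum of `u + ε |x|²` the Laplacian of `u` is at least `-2Nε`. -/
lemma neg_le_lap_of_forall_le {N : ℕ} {u : (Fin N → ℝ) → ℝ} (hu : ContDiff ℝ 2 u) {ε : ℝ}
    {x : Fin N → ℝ} (h : ∀ y, u x + ε * ∑ i, x i ^ 2 ≤ u y + ε * ∑ i, y i ^ 2) :
    -(2 * N * ε) ≤ lap u x := by
  have key : ∀ i : Fin N, -(2 * ε) ≤ pd i (pd i u) x := fun i => by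
    rw [pd_pd_eq_deriv_deriv]
    refine neg_two_mul_le_deriv_deriv (contDiff_comp_update hu x i) fun t => ?_
    have ht := h (Function.update x i t)
    have hsum : ∑ j ∈ Finset.univ.erase i, Function.update x i t j ^ 2
        = ∑ j ∈ Finset.univ.erase i, x j ^ 2 :=
      Finset.sum_congr rfl fun j hj => by
        rw [Function.update_of_ne (Finset.ne_of_mem_erase hj)]
    rw [← Finset.add_sum_erase _ _ (Finset.mem_univ i),
      ← Finset.add_sum_erase _ (fun j => Function.update x i t j ^ 2) (Finset.mem_univ i),
      hsum, Function.update_self] at ht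
    simp only [Function.update_eq_self]
    linarith
  calc -(2 * N * ε) = ∑ _i : Fin N, -(2 * ε) := by simp; ring
    _ ≤ lap u x := Finset.sum_le_sum fun i _ => key i

lemma exists_forall_add_sum_sq_le {N : ℕ} {u : (Fin N → ℝ) → ℝ} (hu : Continuous u)
    (hu_nonneg : ∀ x, 0 ≤ u x) {ε : ℝ} (hε : 0 < ε) :
    ∃ x, ∀ y, u x + ε * ∑ i, x i ^ 2 ≤ u y + ε * ∑ i, y i ^ 2 := by
  refine Continuous.exists_forall_le (f := fun y => u y + ε * ∑ i, y i ^ 2) (by fun_prop) ?_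
  refine tendsto_atTop_mono (f := fun y : Fin N → ℝ => ε * (2 * ‖y‖ - 1)) (fun y => ?_) ?_
  · have hnorm : ‖y‖ ≤ (1 + ∑ i, y i ^ 2) / 2 := by
      refine (pi_norm_le_iff_of_nonneg (by positivity)).2 fun i => ?_
      have hi : y i ^ 2 ≤ ∑ i, y i ^ 2 :=
        Finset.single_le_sum (f := fun i => y i ^ 2) (fun j _ => sq_nonneg _) (Finset.mem_univ i)
      rw [Real.norm_eq_abs]
      nlinarith [sq_nonneg (|y i| - 1), sq_abs (y i)]
    have := mul_le_mul_of_nonneg_left (show 2 * ‖y‖ - 1 ≤ ∑ i, y i ^ 2 by linarith) hε.le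
    linarith [hu_nonneg y]
  · exact (tendsto_atTop_add_const_right _ (-1)
      ((tendsto_norm_cocompact_atTop (E := Fin N → ℝ)).const_mul_atTop two_pos)).const_mul_atTop hε

/-- For a bounded nonnegative `C²` solution `u` of `Δu + f(u) = 0` in `ℝ^N` with `f` locally
Lipschitz, one has `f(m) ≤ 0` where `m = inf_{ℝ^N} u`. -/
theorem stmt_16
    {N : ℕ} (hN : 1 ≤ N) (f : ℝ → ℝ) (hf_lip : LocLipOn f)
    (u : (Fin N → ℝ) → ℝ)
    (hu_smooth : ContDiff ℝ 2 u)
    (hu_nonneg : ∀ x, 0 ≤ u x)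
    (hu_bdd : ∃ C, ∀ x, u x ≤ C)
    (hu_pde : ∀ x, lap u x + f (u x) = 0) :
    f (sInf (Set.range u)) ≤ 0 := by
  obtain ⟨C, hC⟩ := hu_bdd
  obtain ⟨L, hL⟩ := hf_lip C
  set m := sInf (Set.range u)
  have hbdd : BddBelow (Set.range u) := ⟨0, by rintro _ ⟨x, rfl⟩; exact hu_nonneg x⟩
  have hmle : ∀ x, m ≤ u x := fun x => csInf_le hbdd ⟨x, rfl⟩
  have hm0 : 0 ≤ m := le_csInf (Set.range_nonempty u) (by rintro _ ⟨x, rfl⟩; exact hu_nonneg x)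
  have key : ∀ η : ℝ, 0 < η → f m ≤ (2 * N + 2 * L) * η := by
    intro η hη
    obtain ⟨_, ⟨y, rfl⟩, hy⟩ :=
      exists_lt_of_csInf_lt (Set.range_nonempty u) (show sInf (Set.range u) < m + η by linarith)
    have hS : 0 ≤ ∑ i, y i ^ 2 := by positivity
    set S := ∑ i, y i ^ 2 with hSdef
    have hε : 0 < η / (1 + S) := by positivity
    have hεeq : η / (1 + S) * (1 + S) = η := by field_simp
    set ε := η / (1 + S)
    obtain ⟨x, hx⟩ := exists_forall_add_sum_sq_le hu_smooth.continuous hu_nonneg hε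
    have hxu : u x ≤ m + 2 * η := by
      have hxy := hx y
      rw [← hSdef] at hxy
      have hx0 : 0 ≤ ε * ∑ i, x i ^ 2 := by positivity
      linarith
    have hlap := neg_le_lap_of_forall_le hu_smooth hx
    have hεη : 2 * N * ε ≤ 2 * N * η :=
      mul_le_mul_of_nonneg_left (by nlinarith [mul_nonneg hε.le hS]) (by positivity)
    have hdist := hL.dist_le_mul m ⟨hm0, (hmle x).trans (hC x)⟩ (u x) ⟨hu_nonneg x, hC x⟩
    rw [Real.dist_eq, dist_comm, Real.dist_eq, abs_of_nonneg (sub_nonneg.2 (hmle x))] at hdist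
    have hLη : (L : ℝ) * (u x - m) ≤ L * (2 * η) :=
      mul_le_mul_of_nonneg_left (by linarith) L.coe_nonneg
    have := le_abs_self (f m - f (u x))
    linarith [hu_pde x]
  by_contra! hpos
  have hK : (0 : ℝ) < 2 * N + 2 * L + 1 := by positivity
  have hlt := key (f m / (2 * N + 2 * L + 1)) (by positivity)
  have heq : f m / (2 * N + 2 * L + 1) * (2 * N + 2 * L + 1) = f m := by field_simp
  have hq : 0 < f m / (2 * N + 2 * L + 1) := by positivity
  linarith
end
end
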